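/- Quantitative escape estimate (inequality (3.10) in the proof of the paper's transience criterion). Let V : [0,∞) → (0,∞) be a continuous function with V(x) → 0 as x → ∞, and let κ = (κ_t)_{t≥0} be a [0,∞)-valued continuous adapted process satisfying limsup_{t→∞} κ_t = ∞ almost surely. Suppose there exists r₀ > 0 such that for every stopping time T with T < ∞ almost surely and every r ∈ (r₀,∞), E[V(κ_{(t+T)∧S_{r,T}}) | F_{s+T}] ≤ V(κ_{(s+T)∧S_{r,T}}) almost surely for all 0 ≤ s ≤ t < ∞. Then for any ℓ ∈ (r₀,∞) and any r₁ ∈ (ℓ,∞), the probability that κ ever returns to the level ℓ after first reaching level r₁ satisfies P(λ_{ℓ,ρ_{r₁}} < ∞) ≤ V(r₁)/V(ℓ). -/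

import Mathlib

open MeasureTheory Filter Set
open scoped NNReal ENNReal

variable {Ω : Type*}

/-- First time after the stopping time `T` at which `κ` drops to level `ℓ` or below
(`∞` if this never happens, or if `T = ∞`). -/
noncomputable def hitBelow (κ : ℝ≥0 → Ω → ℝ≥0) (ℓ : ℝ≥0) (T : Ω → ℝ≥0∞) (ω : Ω) : ℝ≥0∞ :=
  T ω + sInf ((fun u : ℝ≥0 => (u : ℝ≥0∞)) ''
    {u : ℝ≥0 | T ω ≠ ⊤ ∧ κ ((T ω).toNNReal + u) ω ≤ ℓ})

/-- First time after the stopping time `T` at which `κ` rises to level `r` or above. -/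
noncomputable def hitAbove (κ : ℝ≥0 → Ω → ℝ≥0) (r : ℝ≥0) (T : Ω → ℝ≥0∞) (ω : Ω) : ℝ≥0∞ :=
  T ω + sInf ((fun u : ℝ≥0 => (u : ℝ≥0∞)) ''
    {u : ℝ≥0 | T ω ≠ ⊤ ∧ r ≤ κ ((T ω).toNNReal + u) ω})

/-- `S_{r,T} := λ_{r₀,T} ∧ ρ_{r,T}`, the first exit time from `[r₀, r]` after `T`. -/
noncomputable def exitTime (κ : ℝ≥0 → Ω → ℝ≥0) (r₀ r : ℝ≥0) (T : Ω → ℝ≥0∞) (ω : Ω) : ℝ≥0∞ :=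
  min (hitBelow κ r₀ T ω) (hitAbove κ r T ω)

/-- A `[0,∞]`-valued stopping time for the filtration `ℱ`. -/
def IsStoppingTimeE {m0 : MeasurableSpace Ω} (ℱ : Filtration ℝ≥0 m0) (T : Ω → ℝ≥0∞) : Prop :=
  ∀ t : ℝ≥0, MeasurableSet[ℱ t] {ω | T ω ≤ (t : ℝ≥0∞)}

/-- The σ-algebra `F_T` at the stopping time `T`. -/
noncomputable def stoppedSigma {m0 : MeasurableSpace Ω} (ℱ : Filtration ℝ≥0 m0)
    (T : Ω → ℝ≥0∞) : MeasurableSpace Ω :=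
  MeasurableSpace.generateFrom
    {A | ∀ t : ℝ≥0, MeasurableSet[ℱ t] (A ∩ {ω | T ω ≤ (t : ℝ≥0∞)})}

/-- The stopped process `t ↦ V(κ_{(t+T) ∧ S_{r,T}})`. -/
noncomputable def stoppedV (κ : ℝ≥0 → Ω → ℝ≥0) (V : ℝ≥0 → ℝ) (r₀ r : ℝ≥0)
    (T : Ω → ℝ≥0∞) (t : ℝ≥0) (ω : Ω) : ℝ :=
  V (κ ((min ((t : ℝ≥0∞) + T ω) (exitTime κ r₀ r T ω)).toNNReal) ω)

section FirstHit

/-- The first time at which the process `Y` is nonpositive (`∞` if there is none). -/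
noncomputable def firstHit (Y : ℝ≥0 → Ω → ℝ) (ω : Ω) : ℝ≥0∞ :=
  sInf ((fun u : ℝ≥0 => (u : ℝ≥0∞)) '' {u : ℝ≥0 | Y u ω ≤ 0})

theorem firstHit_le_coe_iff {Y : ℝ≥0 → Ω → ℝ} {ω : Ω} (hY : Continuous fun u => Y u ω)
    (t : ℝ≥0) : firstHit Y ω ≤ t ↔ ∃ u ≤ t, Y u ω ≤ 0 := by
  constructor
  · intro h
    have hne : {u : ℝ≥0 | Y u ω ≤ 0}.Nonempty := by
      by_contra hempty
      rw [Set.not_nonempty_iff_eq_empty] at hempty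
      simp [firstHit, hempty] at h
    have hclosed : IsClosed {u : ℝ≥0 | Y u ω ≤ 0} := isClosed_le hY continuous_const
    refine ⟨sInf {u : ℝ≥0 | Y u ω ≤ 0}, ?_, hclosed.csInf_mem hne (OrderBot.bddBelow _)⟩
    have hle : ((sInf {u : ℝ≥0 | Y u ω ≤ 0} : ℝ≥0) : ℝ≥0∞) ≤ firstHit Y ω := by
      refine le_sInf ?_
      rintro _ ⟨u, hu, rfl⟩
      exact ENNReal.coe_le_coe.2 (csInf_le (OrderBot.bddBelow _) hu)
    exact ENNReal.coe_le_coe.1 (hle.trans h)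
  · rintro ⟨u, hut, hu⟩
    exact sInf_le_of_le (Set.mem_image_of_mem _ hu) (ENNReal.coe_le_coe.2 hut)

theorem firstHit_toNNReal_nonpos {Y : ℝ≥0 → Ω → ℝ} {ω : Ω} (hY : Continuous fun u => Y u ω)
    (h : firstHit Y ω ≠ ⊤) : Y (firstHit Y ω).toNNReal ω ≤ 0 := by
  obtain ⟨u, hu, hYu⟩ := (firstHit_le_coe_iff hY (firstHit Y ω).toNNReal).1
    (ENNReal.coe_toNNReal h).ge
  have hle : firstHit Y ω ≤ u := sInf_le (Set.mem_image_of_mem _ hYu)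
  rwa [hu.antisymm (ENNReal.coe_le_coe.1 ((ENNReal.coe_toNNReal h).trans_le hle))] at hYu

theorem measurableSet_firstHit_le {m : MeasurableSpace Ω} {Y : ℝ≥0 → Ω → ℝ}
    (hcont : ∀ ω, Continuous fun u => Y u ω) (t : ℝ≥0) (hY : ∀ u ≤ t, Measurable (Y u)) :
    MeasurableSet {ω | firstHit Y ω ≤ t} := by
  have hset : {ω | firstHit Y ω ≤ t} =
      ⋂ n : ℕ, ⋃ k : ℕ, {ω | Y (TopologicalSpace.denseSeq (Iic t) k) ω < 1 / ((n : ℝ) + 1)} := by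
    ext ω
    simp only [mem_ofPred_eq, mem_iInter, mem_iUnion, firstHit_le_coe_iff (hcont ω)]
    have hrestr : Continuous fun u : Iic t => Y u ω := (hcont ω).comp continuous_subtype_val
    constructor
    · rintro ⟨u, hu, hYu⟩ n
      have hopen : IsOpen {v : Iic t | Y v ω < 1 / ((n : ℝ) + 1)} :=
        isOpen_lt hrestr continuous_const
      obtain ⟨_, hv, k, rfl⟩ := (TopologicalSpace.denseRange_denseSeq (Iic t)).inter_open_nonempty
        _ hopen ⟨⟨u, hu⟩, lt_of_le_of_lt hYu (by positivity)⟩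
      exact ⟨k, hv⟩
    · intro h
      have hcompact : IsCompact (Iic t) := by
        rw [← Icc_bot]
        exact isCompact_Icc
      obtain ⟨u, hu, hmin⟩ := hcompact.exists_isMinOn ⟨t, le_refl t⟩ (hcont ω).continuousOn
      refine ⟨u, hu, le_of_forall_pos_lt_add fun ε hε => ?_⟩
      obtain ⟨n, hn⟩ := exists_nat_one_div_lt hε
      obtain ⟨k, hk⟩ := h n
      have := hmin (TopologicalSpace.denseSeq (Iic t) k).2
      simp only [mem_ofPred_eq] at this
      linarith
  rw [hset]
  exact MeasurableSet.iInter fun n => MeasurableSet.iUnion fun k =>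
    measurableSet_lt (hY _ (TopologicalSpace.denseSeq (Iic t) k).2) measurable_const

theorem measurable_firstHit {m : MeasurableSpace Ω} {Y : ℝ≥0 → Ω → ℝ}
    (hcont : ∀ ω, Continuous fun u => Y u ω) (hY : ∀ u, Measurable (Y u)) :
    Measurable (firstHit Y) := by
  refine measurable_of_Iic fun x => ?_
  induction x using ENNReal.recTopCoe with
  | top => simp
  | coe t => exact measurableSet_firstHit_le hcont t fun u _ => hY u

end FirstHit

section MaximalInequality

variable {m0 : MeasurableSpace Ω} {μ : Measure Ω}

theorem supermartingale_maximal_nat [IsFiniteMeasure μ] {𝒢 : Filtration ℕ m0} {X : ℕ → Ω → ℝ}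
    (hX : Supermartingale X 𝒢 μ) (hnonneg : ∀ i, 0 ≤ᵐ[μ] X i) {A : Set Ω}
    (hA : MeasurableSet[𝒢 0] A) (c : ℝ) (n : ℕ) :
    c * μ.real (A ∩ {ω | ∃ i ≤ n, c < X i ω}) ≤ ∫ ω in A, X 0 ω ∂μ := by
  have hmeas : ∀ i j, i ≤ j → MeasurableSet[𝒢 j] {ω | c < X i ω} := fun i j hij =>
    𝒢.mono hij _ (measurableSet_lt measurable_const (hX.1 i).measurable)
  have hE : ∀ n, MeasurableSet[𝒢 n] {ω | ∃ i ≤ n, c < X i ω} := fun n => by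
    have : {ω | ∃ i ≤ n, c < X i ω} = ⋃ i, ⋃ (_ : i ≤ n), {ω | c < X i ω} := by
      ext; simp
    rw [this]
    exact MeasurableSet.iUnion fun i => MeasurableSet.iUnion fun hi => hmeas i n hi
  have hsplit : ∀ (k : ℕ) (D : Set Ω), MeasurableSet D →
      c * μ.real (D ∩ {ω | c < X k ω}) + ∫ ω in D \ {ω | c < X k ω}, X k ω ∂μ
        ≤ ∫ ω in D, X k ω ∂μ := fun k D hD => by
    have hk : MeasurableSet {ω | c < X k ω} := 𝒢.le k _ (hmeas k k le_rfl)
    have hadd := integral_inter_add_sdiff hk (hX.2.2 k).integrableOn (s := D)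
    have hDk : c * μ.real (D ∩ {ω | c < X k ω}) ≤ ∫ ω in D ∩ {ω | c < X k ω}, X k ω ∂μ :=
      setIntegral_ge_of_const_le_real (hD.inter hk) (measure_ne_top _ _)
        (fun ω hω => le_of_lt hω.2) (hX.2.2 k).integrableOn
    linarith
  have key : ∀ n, c * μ.real (A ∩ {ω | ∃ i ≤ n, c < X i ω})
      + ∫ ω in A \ {ω | ∃ i ≤ n, c < X i ω}, X n ω ∂μ ≤ ∫ ω in A, X 0 ω ∂μ := by
    intro n
    induction n with
    | zero => simpa using hsplit 0 A (𝒢.le 0 _ hA)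
    | succ n ih =>
      set E := {ω | ∃ i ≤ n, c < X i ω} with hEdef
      have hE' : {ω | ∃ i ≤ n + 1, c < X i ω} = E ∪ {ω | c < X (n + 1) ω} := by
        ext ω
        simp only [hEdef, mem_ofPred_eq, mem_union, Nat.le_succ_iff, or_and_right, exists_or,
          exists_eq_left]
      have hAn : MeasurableSet[𝒢 n] A := 𝒢.mono (Nat.zero_le n) _ hA
      have hD : MeasurableSet[𝒢 n] (A \ E) := hAn.diff (hE n)
      have h1 := hX.setIntegral_le n.le_succ hD
      have h2 := hsplit (n + 1) (A \ E) (𝒢.le n _ hD)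
      have h3 : μ.real (A ∩ (E ∪ {ω | c < X (n + 1) ω}))
          = μ.real (A ∩ E) + μ.real ((A \ E) ∩ {ω | c < X (n + 1) ω}) := by
        rw [← measureReal_union]
        · congr 1
          ext ω
          simp only [mem_inter_iff, mem_union, Set.mem_sdiff]
          tauto
        · exact Set.disjoint_left.2 fun ω h h' => h'.1.2 h.2
        · exact (𝒢.le n _ hD).inter (𝒢.le (n + 1) _ (hmeas _ _ le_rfl))
      rw [hE', h3, ← Set.sdiff_sdiff]
      simp only [Nat.succ_eq_add_one] at h1
      linarith
  refine le_trans ?_ (key n)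
  exact le_add_of_nonneg_right (setIntegral_nonneg_of_ae (hnonneg n))

theorem supermartingale_maximal_nnreal [IsFiniteMeasure μ] {𝒢 : Filtration ℝ≥0 m0}
    {M : ℝ≥0 → Ω → ℝ} (hint : ∀ t, Integrable (M t) μ) (hnonneg : ∀ t ω, 0 ≤ M t ω)
    (hcont : ∀ ω, Continuous fun t => M t ω)
    (hsup : ∀ s t, s ≤ t → μ[M t | 𝒢 s] ≤ᵐ[μ] M s)
    {A : Set Ω} (hA : MeasurableSet[𝒢 0] A) {c : ℝ} (hc : 0 < c) :
    μ (A ∩ {ω | ∃ u, c < M u ω}) ≤ ENNReal.ofReal ((∫ ω in A, M 0 ω ∂μ) / c) := by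
  have hversion : ∀ s, μ[M s | 𝒢 s] =ᵐ[μ] M s := fun s =>
    (integral_eq_iff_of_ae_le integrable_condExp (hint s) (hsup s s le_rfl)).1
      (integral_condExp (𝒢.le s))
  have hgrid : ∀ k n : ℕ,
      μ (A ∩ {ω | ∃ i ≤ n, c < M ((i : ℝ≥0) / 2 ^ k) ω})
        ≤ ENNReal.ofReal ((∫ ω in A, M 0 ω ∂μ) / c) := by
    intro k n
    let time : ℕ → ℝ≥0 := fun i => (i : ℝ≥0) / 2 ^ k
    have htime : Monotone time := fun i j hij => by simp only [time]; gcongr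
    have htime0 : time 0 = 0 := by simp [time]
    let 𝒦 : Filtration ℕ m0 :=
      ⟨fun i => 𝒢 (time i), fun i j hij => 𝒢.mono (htime hij), fun i => 𝒢.le _⟩
    have hX : Supermartingale (fun i => μ[M (time i) | 𝒢 (time i)]) 𝒦 μ := by
      refine ⟨fun i => stronglyMeasurable_condExp, fun i j hij => ?_, fun i => integrable_condExp⟩
      exact (condExp_congr_ae (hversion (time j))).trans_le
        ((hsup _ _ (htime hij)).trans_eq (hversion (time i)).symm)
    have hmax := supermartingale_maximal_nat hX
      (fun i => (hversion (time i)).mono fun ω h => (hnonneg (time i) ω).trans_eq h.symm)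
      (A := A) (by change MeasurableSet[𝒢 (time 0)] A; rwa [htime0]) c n
    rw [htime0, setIntegral_congr_ae (𝒢.le 0 _ hA) ((hversion 0).mono fun ω h _ => h),
      mul_comm, ← le_div_iff₀ hc] at hmax
    have hae : μ (A ∩ {ω | ∃ i ≤ n, c < M (time i) ω})
        = μ (A ∩ {ω | ∃ i ≤ n, c < μ[M (time i) | 𝒢 (time i)] ω}) := by
      refine measure_congr ?_
      have hall : ∀ᵐ ω ∂μ, ∀ i, μ[M (time i) | 𝒢 (time i)] ω = M (time i) ω :=
        ae_all_iff.2 fun i => hversion (time i)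
      filter_upwards [hall] with ω hω
      apply propext
      change (ω ∈ A ∧ _) ↔ (ω ∈ A ∧ _)
      simp [hω]
    rw [show (A ∩ {ω | ∃ i ≤ n, c < M ((i : ℝ≥0) / 2 ^ k) ω})
      = A ∩ {ω | ∃ i ≤ n, c < M (time i) ω} from rfl, hae]
    exact (ENNReal.le_ofReal_iff_toReal_le (measure_ne_top _ _)
      (measureReal_nonneg.trans hmax)).2 hmax
  have hcover : A ∩ {ω | ∃ u, c < M u ω}
      ⊆ ⋃ k : ℕ, A ∩ {ω | ∃ i : ℕ, c < M ((i : ℝ≥0) / 2 ^ k) ω} := by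
    rintro ω ⟨hωA, u, hu⟩
    have htend : Tendsto (fun k : ℕ => ((⌊(u : ℝ) * 2 ^ k⌋₊ : ℕ) : ℝ≥0) / 2 ^ k) atTop
        (nhds u) := by
      rw [← NNReal.tendsto_coe]
      push_cast
      exact (tendsto_nat_floor_mul_div_atTop u.2).comp
        (tendsto_pow_atTop_atTop_of_one_lt (one_lt_two (α := ℝ)))
    obtain ⟨k, hk⟩ := (((hcont ω).tendsto u).comp htend).eventually_const_lt hu |>.exists
    exact mem_iUnion.2 ⟨k, hωA, _, hk⟩
  have hunion : ∀ k : ℕ, A ∩ {ω | ∃ i : ℕ, c < M ((i : ℝ≥0) / 2 ^ k) ω}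
      = ⋃ n : ℕ, A ∩ {ω | ∃ i ≤ n, c < M ((i : ℝ≥0) / 2 ^ k) ω} := fun k => by
    ext ω
    simp only [mem_inter_iff, mem_ofPred_eq, mem_iUnion]
    exact ⟨fun ⟨h, i, hi⟩ => ⟨i, h, i, le_rfl, hi⟩, fun ⟨_, h, i, _, hi⟩ => ⟨h, i, hi⟩⟩
  refine (measure_mono hcover).trans ?_
  rw [Monotone.measure_iUnion]
  · refine iSup_le fun k => ?_
    rw [hunion k, Monotone.measure_iUnion]
    · exact iSup_le fun n => hgrid k n
    · exact fun n m hnm ω ⟨h, i, hi, hM⟩ => ⟨h, i, hi.trans hnm, hM⟩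
  · refine monotone_nat_of_le_succ fun k => ?_
    rintro ω ⟨h, i, hi⟩
    refine ⟨h, 2 * i, ?_⟩
    convert hi using 2
    push_cast
    rw [pow_succ', mul_div_mul_left _ _ two_ne_zero]

end MaximalInequality

section ExitTime

variable {m0 : MeasurableSpace Ω}

theorem hitBelow_eq_add_firstHit (κ : ℝ≥0 → Ω → ℝ≥0) (ℓ : ℝ≥0) {T : Ω → ℝ≥0∞} {ω : Ω}
    (hT : T ω ≠ ⊤) :
    hitBelow κ ℓ T ω = T ω + firstHit (fun u ω => (κ ((T ω).toNNReal + u) ω : ℝ) - ℓ) ω := by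
  simp [hitBelow, firstHit, hT]

theorem hitAbove_eq_add_firstHit (κ : ℝ≥0 → Ω → ℝ≥0) (r : ℝ≥0) {T : Ω → ℝ≥0∞} {ω : Ω}
    (hT : T ω ≠ ⊤) :
    hitAbove κ r T ω = T ω + firstHit (fun u ω => (r : ℝ) - κ ((T ω).toNNReal + u) ω) ω := by
  simp [hitAbove, firstHit, hT]

theorem le_exitTime (κ : ℝ≥0 → Ω → ℝ≥0) (r₀ r : ℝ≥0) (T : Ω → ℝ≥0∞) (ω : Ω) :
    T ω ≤ exitTime κ r₀ r T ω :=
  le_min le_self_add le_self_add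

theorem measurable_exitTime {κ : ℝ≥0 → Ω → ℝ≥0} (hκ : ∀ t, Measurable (κ t))
    (hcont : ∀ ω, Continuous fun t => κ t ω) (r₀ r : ℝ≥0) {T : Ω → ℝ≥0∞} (hT : Measurable T)
    (hfin : ∀ ω, T ω ≠ ⊤) : Measurable (exitTime κ r₀ r T) := by
  have hshift : ∀ u, Measurable fun ω => (κ ((T ω).toNNReal + u) ω : ℝ) := fun u =>
    ((measurable_uncurry_of_continuous_of_measurable hcont hκ).comp
      ((hT.ennreal_toNNReal.add_const u).prodMk measurable_id)).coe_nnreal_real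
  have hshiftcont : ∀ ω, Continuous fun u => (κ ((T ω).toNNReal + u) ω : ℝ) := fun ω =>
    NNReal.continuous_coe.comp ((hcont ω).comp (continuous_const.add continuous_id))
  have hbelow : hitBelow κ r₀ T =
      fun ω => T ω + firstHit (fun u ω => (κ ((T ω).toNNReal + u) ω : ℝ) - r₀) ω :=
    funext fun ω => hitBelow_eq_add_firstHit κ r₀ (hfin ω)
  have habove : hitAbove κ r T =
      fun ω => T ω + firstHit (fun u ω => (r : ℝ) - κ ((T ω).toNNReal + u) ω) ω :=
    funext fun ω => hitAbove_eq_add_firstHit κ r (hfin ω)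
  refine Measurable.min ?_ ?_
  · rw [hbelow]
    exact hT.add (measurable_firstHit (fun ω => (hshiftcont ω).sub continuous_const)
      fun u => (hshift u).sub_const _)
  · rw [habove]
    exact hT.add (measurable_firstHit (fun ω => continuous_const.sub (hshiftcont ω))
      fun u => (hshift u).const_sub _)

theorem measurable_stoppedV {κ : ℝ≥0 → Ω → ℝ≥0} (hκ : ∀ t, Measurable (κ t))
    (hcont : ∀ ω, Continuous fun t => κ t ω) {V : ℝ≥0 → ℝ} (hV : Measurable V) (r₀ r : ℝ≥0)
    {T : Ω → ℝ≥0∞} (hT : Measurable T) (hfin : ∀ ω, T ω ≠ ⊤) (t : ℝ≥0) :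
    Measurable (stoppedV κ V r₀ r T t) :=
  hV.comp ((measurable_uncurry_of_continuous_of_measurable hcont hκ).comp
    (((hT.const_add _).min (measurable_exitTime hκ hcont r₀ r hT hfin)).ennreal_toNNReal.prodMk
      measurable_id))

theorem continuous_stoppedV {κ : ℝ≥0 → Ω → ℝ≥0} {V : ℝ≥0 → ℝ} (hV : Continuous V) (r₀ r : ℝ≥0)
    {T : Ω → ℝ≥0∞} {ω : Ω} (hcont : Continuous fun t => κ t ω) (hfin : T ω ≠ ⊤) :
    Continuous fun t => stoppedV κ V r₀ r T t ω := by
  refine hV.comp (hcont.comp ?_)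
  refine ENNReal.continuousOn_toNNReal.comp_continuous
    ((ENNReal.continuous_coe.add continuous_const).min continuous_const) fun t => ?_
  exact ((min_le_left _ _).trans_lt (ENNReal.add_lt_top.2 ⟨ENNReal.coe_lt_top, hfin.lt_top⟩)).ne

theorem stoppedV_zero (κ : ℝ≥0 → Ω → ℝ≥0) (V : ℝ≥0 → ℝ) (r₀ r : ℝ≥0) (T : Ω → ℝ≥0∞) (ω : Ω) :
    stoppedV κ V r₀ r T 0 ω = V (κ (T ω).toNNReal ω) := by
  simp [stoppedV, le_exitTime]

theorem exists_stoppedV_eq {κ : ℝ≥0 → Ω → ℝ≥0} (V : ℝ≥0 → ℝ) {r₀ r ℓ u : ℝ≥0} {T : Ω → ℝ≥0∞}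
    {ω : Ω} (hcont : Continuous fun t => κ t ω) (hr₀ : r₀ < ℓ) (hfin : T ω ≠ ⊤)
    (hstart : ℓ ≤ κ (T ω).toNNReal ω) (hTu : T ω ≤ u) (hu : κ u ω ≤ ℓ)
    (hr : ∀ v ≤ u, κ v ω < r) : ∃ t, stoppedV κ V r₀ r T t ω = V ℓ := by
  set τ := (T ω).toNNReal
  have hTτ : T ω = τ := (ENNReal.coe_toNNReal hfin).symm
  have hτu : τ ≤ u := by
    rw [hTτ] at hTu
    exact ENNReal.coe_le_coe.1 hTu
  have hclosed : IsClosed {w | τ ≤ w ∧ κ w ω ≤ ℓ} :=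
    isClosed_Ici.inter (isClosed_Iic.preimage hcont)
  set w := sInf {w | τ ≤ w ∧ κ w ω ≤ ℓ}
  obtain ⟨hτw, hκw⟩ : τ ≤ w ∧ κ w ω ≤ ℓ := hclosed.csInf_mem ⟨u, hτu, hu⟩ (OrderBot.bddBelow _)
  have hmin : ∀ v, τ ≤ v → κ v ω ≤ ℓ → w ≤ v := fun v h1 h2 =>
    csInf_le (OrderBot.bddBelow _) ⟨h1, h2⟩
  have hκwℓ : κ w ω = ℓ := by
    obtain ⟨v, hv, hvℓ⟩ := intermediate_value_Icc' hτw hcont.continuousOn ⟨hκw, hstart⟩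
    rwa [← hv.2.antisymm (hmin v hv.1 (le_of_eq hvℓ))]
  have hτw' : τ + (w - τ) = w := add_tsub_cancel_of_le hτw
  have hexit : (w : ℝ≥0∞) ≤ exitTime κ r₀ r T ω := by
    have hle : ∀ v : ℝ≥0, w ≤ τ + v → ((w - τ : ℝ≥0) : ℝ≥0∞) ≤ v := fun v hv =>
      ENNReal.coe_le_coe.2 (tsub_le_iff_left.2 hv)
    rw [← hτw', ENNReal.coe_add, ← hTτ]
    refine le_min (add_le_add le_rfl (le_sInf ?_)) (add_le_add le_rfl (le_sInf ?_))
    · rintro _ ⟨v, ⟨-, hv⟩, rfl⟩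
      exact hle v (hmin _ le_self_add (hv.trans hr₀.le))
    · rintro _ ⟨v, ⟨-, hv⟩, rfl⟩
      refine hle v ((hmin u hτu hu).trans (le_of_lt ?_))
      by_contra! hcon
      exact absurd (hr _ hcon) (not_lt.2 hv)
  refine ⟨w - τ, ?_⟩
  have htime : ((w - τ : ℝ≥0) : ℝ≥0∞) + T ω = w := by
    rw [hTτ, ← ENNReal.coe_add, tsub_add_cancel_of_le hτw]
  rw [stoppedV, htime, min_eq_left hexit, ENNReal.toNNReal_coe, hκwℓ]

end ExitTime

section StoppedSigma

variable {m0 : MeasurableSpace Ω} {ℱ : Filtration ℝ≥0 m0}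

theorem IsStoppingTimeE.add_const {T : Ω → ℝ≥0∞} (hT : IsStoppingTimeE ℱ T) (s : ℝ≥0) :
    IsStoppingTimeE ℱ fun ω => T ω + s := by
  intro t
  by_cases hst : s ≤ t
  · have : {ω | T ω + s ≤ t} = {ω | T ω ≤ ((t - s : ℝ≥0) : ℝ≥0∞)} := by
      ext ω
      rw [mem_ofPred_eq, mem_ofPred_eq, ENNReal.coe_sub]
      exact (ENNReal.le_sub_iff_add_le_right ENNReal.coe_ne_top (ENNReal.coe_le_coe.2 hst)).symm
    rw [this]
    exact ℱ.mono tsub_le_self _ (hT _)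
  · have : {ω | T ω + s ≤ t} = ∅ := by
      refine Set.eq_empty_of_forall_notMem fun ω hω => hst ?_
      exact ENNReal.coe_le_coe.1 (le_add_self.trans hω)
    rw [this]
    exact @MeasurableSet.empty _ (ℱ t)

theorem IsStoppingTimeE.measurable {T : Ω → ℝ≥0∞} (hT : IsStoppingTimeE ℱ T) : Measurable T := by
  refine measurable_of_Iic fun x => ?_
  induction x using ENNReal.recTopCoe with
  | top => simp
  | coe t => exact ℱ.le t _ (hT t)

theorem stoppedSigma_mono {T T' : Ω → ℝ≥0∞} (hT' : IsStoppingTimeE ℱ T') (hle : T ≤ T') :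
    stoppedSigma ℱ T ≤ stoppedSigma ℱ T' := by
  refine MeasurableSpace.generateFrom_mono fun A hA t => ?_
  have : A ∩ {ω | T' ω ≤ t} = (A ∩ {ω | T ω ≤ t}) ∩ {ω | T' ω ≤ t} := by
    ext ω
    exact ⟨fun h => ⟨⟨h.1, (hle ω).trans h.2⟩, h.2⟩, fun h => ⟨h.1.1, h.2⟩⟩
  rw [this]
  exact (hA t).inter (hT' t)

theorem stoppedSigma_le {T : Ω → ℝ≥0∞} (hfin : ∀ ω, T ω ≠ ⊤) : stoppedSigma ℱ T ≤ m0 := by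
  refine MeasurableSpace.generateFrom_le fun A hA => ?_
  have : A = ⋃ n : ℕ, A ∩ {ω | T ω ≤ ((n : ℝ≥0) : ℝ≥0∞)} := by
    ext ω
    simp only [mem_iUnion, mem_inter_iff, exists_and_left, mem_ofPred_eq, ENNReal.coe_natCast]
    obtain ⟨n, hn⟩ := ENNReal.exists_nat_gt (hfin ω)
    exact ⟨fun h => ⟨h, n, hn.le⟩, And.left⟩
  rw [this]
  exact MeasurableSet.iUnion fun n => ℱ.le n _ (hA n)

/-- The filtration `s ↦ F_{T+s}`, for a finite stopping time `T`. -/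
noncomputable def shiftedFiltration {T : Ω → ℝ≥0∞} (hT : IsStoppingTimeE ℱ T)
    (hfin : ∀ ω, T ω ≠ ⊤) : Filtration ℝ≥0 m0 where
  seq s := stoppedSigma ℱ fun ω => T ω + s
  mono' _ t hst := stoppedSigma_mono (hT.add_const t) fun _ =>
    add_le_add le_rfl (ENNReal.coe_le_coe.2 hst)
  le' _ := stoppedSigma_le fun ω => ENNReal.add_ne_top.2 ⟨hfin ω, ENNReal.coe_ne_top⟩

end StoppedSigma

theorem measure_exists_lt_stoppedV_le
    {m0 : MeasurableSpace Ω} {μ : Measure Ω} [IsProbabilityMeasure μ] {ℱ : Filtration ℝ≥0 m0}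
    {κ : ℝ≥0 → Ω → ℝ≥0} (hκ : ∀ t, Measurable (κ t)) (hcont : ∀ ω, Continuous fun t => κ t ω)
    {V : ℝ≥0 → ℝ} (hVcont : Continuous V) (hVnonneg : ∀ x, 0 ≤ V x) {C : ℝ} (hVle : ∀ x, V x ≤ C)
    {r₀ r : ℝ≥0} {T : Ω → ℝ≥0∞} (hT : IsStoppingTimeE ℱ T) (hfin : ∀ ω, T ω ≠ ⊤)
    (hsup : ∀ s t : ℝ≥0, s ≤ t →
      μ[stoppedV κ V r₀ r T t | stoppedSigma ℱ (fun ω => T ω + (s : ℝ≥0∞))]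
        ≤ᵐ[μ] stoppedV κ V r₀ r T s)
    {A : Set Ω} (hA : ∀ t : ℝ≥0, MeasurableSet[ℱ t] (A ∩ {ω | T ω ≤ t})) {K : ℝ} (hK : 0 ≤ K)
    (hinit : ∀ ω ∈ A, V (κ (T ω).toNNReal ω) ≤ K) {c : ℝ} (hc : 0 < c) :
    μ (A ∩ {ω | ∃ u, c < stoppedV κ V r₀ r T u ω}) ≤ ENNReal.ofReal (K / c) := by
  have hAT : MeasurableSet[shiftedFiltration hT hfin 0] A := by
    change MeasurableSet[stoppedSigma ℱ fun ω => T ω + ((0 : ℝ≥0) : ℝ≥0∞)] A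
    have hzero : (fun ω => T ω + ((0 : ℝ≥0) : ℝ≥0∞)) = T := by simp
    rw [hzero]
    exact MeasurableSpace.measurableSet_generateFrom hA
  have hint : ∀ t, Integrable (stoppedV κ V r₀ r T t) μ := fun t =>
    Integrable.of_bound
      (measurable_stoppedV hκ hcont hVcont.measurable r₀ r hT.measurable hfin t).aestronglyMeasurable
      C (Eventually.of_forall fun ω => by
        exact (Real.norm_of_nonneg (hVnonneg _)).trans_le (hVle _))
  refine (supermartingale_maximal_nnreal (𝒢 := shiftedFiltration hT hfin) hint
    (fun _ _ => hVnonneg _) (fun ω => continuous_stoppedV hVcont r₀ r (hcont ω) (hfin ω))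
    hsup hAT hc).trans ?_
  gcongr
  calc ∫ ω in A, stoppedV κ V r₀ r T 0 ω ∂μ
      ≤ ∫ _ in A, K ∂μ := by
        refine setIntegral_mono_on (hint 0).integrableOn (integrable_const K).integrableOn
          ((shiftedFiltration hT hfin).le 0 _ hAT) fun ω hω => ?_
        rw [stoppedV_zero]
        exact hinit ω hω
    _ = μ.real A * K := by simp
    _ ≤ K := mul_le_of_le_one_left hK measureReal_le_one

theorem exists_forall_le_of_tendsto_atTop {V : ℝ≥0 → ℝ} (hV : Continuous V) {a : ℝ}
    (hlim : Tendsto V atTop (nhds a)) : ∃ C, ∀ x, V x ≤ C := by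
  obtain ⟨R, hR⟩ := eventually_atTop.1 (hlim.eventually_lt_const (lt_add_one a))
  obtain ⟨C, hC⟩ := (isCompact_Icc (a := (0 : ℝ≥0)) (b := R)).bddAbove_image hV.continuousOn
  refine ⟨max (a + 1) C, fun x => ?_⟩
  rcases le_total R x with h | h
  · exact (hR x h).le.trans (le_max_left _ _)
  · exact (hC ⟨x, ⟨zero_le, h⟩, rfl⟩).trans (le_max_right _ _)

/-- **Quantitative escape estimate** (inequality (3.10)): under the hypotheses of the
transience criterion, for any `ℓ ∈ (r₀,∞)` and `r₁ ∈ (ℓ,∞)`, the probability that `κ`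
ever returns to level `ℓ` after first reaching level `r₁` is at most `V(r₁)/V(ℓ)`. -/
theorem quantitative_escape_estimate
    {m0 : MeasurableSpace Ω} {μ : Measure Ω} [IsProbabilityMeasure μ]
    (ℱ : Filtration ℝ≥0 m0)
    (κ : ℝ≥0 → Ω → ℝ≥0)
    (hadapt : ∀ t : ℝ≥0, Measurable[ℱ t] (κ t))
    (hcont : ∀ ω, Continuous fun t => κ t ω)
    (hlimsup : ∀ᵐ ω ∂μ, Filter.limsup (fun t => (κ t ω : ℝ≥0∞)) atTop = ⊤)
    (V : ℝ≥0 → ℝ) (hVcont : Continuous V) (hVpos : ∀ x, 0 < V x)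
    (hVzero : Tendsto V atTop (nhds 0))
    (r₀ : ℝ≥0) (hr₀ : 0 < r₀)
    (hsup : ∀ T : Ω → ℝ≥0∞, IsStoppingTimeE ℱ T → (∀ᵐ ω ∂μ, T ω ≠ ⊤) →
      ∀ r : ℝ≥0, r₀ < r →
        ∀ s t : ℝ≥0, s ≤ t →
          μ[stoppedV κ V r₀ r T t | stoppedSigma ℱ (fun ω => T ω + (s : ℝ≥0∞))]
            ≤ᵐ[μ] stoppedV κ V r₀ r T s) :
    ∀ ℓ r₁ : ℝ≥0, r₀ < ℓ → ℓ < r₁ →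
      μ {ω | hitBelow κ ℓ (fun ω' => hitAbove κ r₁ (fun _ => 0) ω') ω ≠ ⊤}
        ≤ ENNReal.ofReal (V r₁ / V ℓ) := by
  intro ℓ r₁ hr₀ℓ hℓr₁
  obtain ⟨C, hC⟩ := exists_forall_le_of_tendsto_atTop hVcont hVzero
  have hκ : ∀ t, Measurable (κ t) := fun t => (hadapt t).mono (ℱ.le t) le_rfl
  let Y : ℝ≥0 → Ω → ℝ := fun u ω => |(κ u ω : ℝ) - r₁|
  have hYcont : ∀ ω, Continuous fun u => Y u ω := fun ω =>
    ((NNReal.continuous_coe.comp (hcont ω)).sub continuous_const).abs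
  have hYzero : ∀ {u ω}, Y u ω ≤ 0 ↔ κ u ω = r₁ := fun {u ω} => by
    rw [abs_nonpos_iff, sub_eq_zero, NNReal.coe_inj]
  have hT : IsStoppingTimeE ℱ (firstHit Y) := fun t => by
    refine measurableSet_firstHit_le hYcont t fun u hu => ?_
    have := ((hadapt u).mono (ℱ.mono hu) le_rfl).coe_nnreal_real
    exact continuous_abs.measurable.comp (this.sub_const _)
  have hκT : ∀ ω, firstHit Y ω ≠ ⊤ → κ (firstHit Y ω).toNNReal ω = r₁ := fun ω h =>
    hYzero.1 (firstHit_toNNReal_nonpos (hYcont ω) h)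
  let B : ℕ → Set Ω := fun n => {ω | firstHit Y ω ≤ (n : ℝ≥0) ∧
    ∃ u : ℝ≥0, firstHit Y ω ≤ u ∧ κ u ω ≤ ℓ ∧ ∀ v ≤ u, κ v ω < n + r₀ + 1}
  have hcover : {ω | hitBelow κ ℓ (fun ω' => hitAbove κ r₁ (fun _ => 0) ω') ω ≠ ⊤} ⊆ ⋃ n, B n := by
    intro ω hω
    rw [mem_ofPred_eq] at hω
    set ρ := hitAbove κ r₁ (fun _ => 0) ω with hρ
    have hρfin : ρ ≠ ⊤ := fun h => hω (by simp [hitBelow, ← hρ, h])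
    obtain ⟨v, hvρ, hv⟩ : ∃ v ≤ ρ.toNNReal, r₁ ≤ κ v ω := by
      have hle : hitAbove κ r₁ (fun _ => 0) ω ≤ ρ.toNNReal := (ENNReal.coe_toNNReal hρfin).ge
      rw [hitAbove_eq_add_firstHit κ r₁ (by simp), zero_add, firstHit_le_coe_iff] at hle
      · simpa using hle
      · simp only [ENNReal.toNNReal_zero, zero_add]
        exact continuous_const.sub (NNReal.continuous_coe.comp (hcont ω))
    obtain ⟨u, hu⟩ : ∃ u, κ (ρ.toNNReal + u) ω ≤ ℓ := by
      by_contra! h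
      refine hω ?_
      simp [hitBelow, ← hρ, not_le.2 (h _)]
    obtain ⟨w, hw, hκw⟩ := intermediate_value_Icc' (hvρ.trans (le_self_add (b := u)))
      (hcont ω).continuousOn ⟨hu.trans hℓr₁.le, hv⟩
    have hTw : firstHit Y ω ≤ w := (firstHit_le_coe_iff (hYcont ω) w).2 ⟨w, le_rfl, hYzero.2 hκw⟩
    obtain ⟨D, hD⟩ := (isCompact_Icc (a := (0 : ℝ≥0)) (b := ρ.toNNReal + u)).bddAbove_image
      (hcont ω).continuousOn
    obtain ⟨n, hn⟩ := exists_nat_ge (max w D)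
    refine mem_iUnion.2 ⟨n, hTw.trans (ENNReal.coe_le_coe.2 ((le_max_left _ _).trans hn)),
      ρ.toNNReal + u, hTw.trans (ENNReal.coe_le_coe.2 hw.2), hu, fun x hx => ?_⟩
    calc κ x ω ≤ D := hD ⟨x, ⟨zero_le, hx⟩, rfl⟩
      _ ≤ n := (le_max_right _ _).trans hn
      _ ≤ n + r₀ := le_self_add
      _ < n + r₀ + 1 := lt_add_one _
  have hB : ∀ n (c : ℝ), 0 < c → c < V ℓ → μ (B n) ≤ ENNReal.ofReal (V r₁ / c) := by
    intro n c hc hcℓ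
    let S : Ω → ℝ≥0∞ := fun ω => min (firstHit Y ω) (n : ℝ≥0)
    have hS : IsStoppingTimeE ℱ S := fun t => by
      have : {ω | S ω ≤ t} = {ω | firstHit Y ω ≤ t} ∪ {_ω | ((n : ℝ≥0) : ℝ≥0∞) ≤ t} := by
        ext ω
        exact min_le_iff (b := firstHit Y ω)
      rw [this]
      exact (hT t).union (@MeasurableSet.const _ (ℱ t) _)
    have hSfin : ∀ ω, S ω ≠ ⊤ := fun ω =>
      ((min_le_right _ _).trans_lt ENNReal.coe_lt_top).ne
    let A : Set Ω := {ω | firstHit Y ω ≤ (n : ℝ≥0)}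
    have hSA : ∀ ω ∈ A, S ω = firstHit Y ω := fun ω hω => min_eq_left hω
    have hA : ∀ t : ℝ≥0, MeasurableSet[ℱ t] (A ∩ {ω | S ω ≤ t}) := fun t => by
      have : A ∩ {ω | S ω ≤ t} = {ω | firstHit Y ω ≤ (min (n : ℝ≥0) t : ℝ≥0)} := by
        ext ω
        rw [mem_ofPred_eq, ENNReal.coe_min, le_min_iff]
        exact ⟨fun h => ⟨h.1, (hSA ω h.1) ▸ h.2⟩, fun h => ⟨h.1, (min_le_left _ _).trans h.2⟩⟩
      rw [this]
      exact ℱ.mono (min_le_right _ _) _ (hT _)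
    have hκS : ∀ ω ∈ A, κ (S ω).toNNReal ω = r₁ := fun ω hω => by
      rw [hSA ω hω]
      exact hκT ω (ne_top_of_le_ne_top ENNReal.coe_ne_top hω)
    have hr : r₀ < n + r₀ + 1 := (le_add_self).trans_lt (lt_add_one _)
    refine le_trans (measure_mono ?_) (measure_exists_lt_stoppedV_le hκ hcont hVcont
      (fun x => (hVpos x).le) hC hS hSfin
      (hsup S hS (Eventually.of_forall hSfin) (n + r₀ + 1) hr) hA (hVpos r₁).le
      (fun ω hω => by rw [hκS ω hω]) hc)
    rintro ω ⟨hωA, u, hu, hκu, hbound⟩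
    obtain ⟨t, ht⟩ := exists_stoppedV_eq V (hcont ω) hr₀ℓ (hSfin ω)
      (by rw [hκS ω hωA]; exact hℓr₁.le) ((min_le_left _ _).trans hu) hκu hbound
    exact ⟨hωA, t, ht ▸ hcℓ⟩
  have hBmono : Monotone B := by
    rintro n m hnm ω ⟨h, u, hu, hκu, hbound⟩
    have hnm' : (n : ℝ≥0) ≤ m := by exact_mod_cast hnm
    exact ⟨h.trans (ENNReal.coe_le_coe.2 hnm'), u, hu, hκu,
      fun v hv => (hbound v hv).trans_le (by gcongr)⟩
  refine (measure_mono hcover).trans ?_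
  rw [hBmono.measure_iUnion]
  refine iSup_le fun n => ?_
  have hlim : Tendsto (fun c => ENNReal.ofReal (V r₁ / c)) (nhdsWithin (V ℓ) (Iio (V ℓ)))
      (nhds (ENNReal.ofReal (V r₁ / V ℓ))) :=
    ENNReal.tendsto_ofReal ((tendsto_const_nhds.div tendsto_id (hVpos ℓ).ne').mono_left
      nhdsWithin_le_nhds)
  refine ge_of_tendsto hlim ?_
  filter_upwards [Ioo_mem_nhdsLT (hVpos ℓ)] with c hc
  exact hB n c hc.1 hc.2
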